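/- Let γ and κ be distinct cyclic permutations of {0,1,2,3,4}, and suppose P = {τ, τ'} is a route of size 2 from γ to κ in which the two transpositions τ and τ' involve, in total, four distinct symbols of {0,1,2,3,4} (i.e., they have disjoint supports). Then P is the only route of size 2 from γ to κ. -/

import Mathlib

/-- The cyclic permutation `(a b c d e)` of `Fin 5`, sending `a ↦ b ↦ c ↦ d ↦ e ↦ a`. -/
def cyc5 (a b c d e : Fin 5) : Equiv.Perm (Fin 5) :=
  Equiv.swap a e * Equiv.swap a d * Equiv.swap a c * Equiv.swap a b

/-- A permutation is *cyclic* if it consists of a single cycle through all elements. -/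
def IsCyclicPerm {α : Type*} [Fintype α] [DecidableEq α] (σ : Equiv.Perm α) : Prop :=
  σ.IsCycle ∧ σ.support = Finset.univ

/-- `RouteList γ L κ` holds when successively applying the transpositions in the list `L`
(each, at the moment it is applied, being a swap of two symbols adjacent in the current
cyclic permutation, and acting by conjugation, i.e. by interchanging the two symbols)
transforms `γ` into `κ`. -/
def RouteList {α : Type*} [DecidableEq α] :
    Equiv.Perm α → List (Equiv.Perm α) → Equiv.Perm α → Prop
  | γ, [], κ => γ = κ
  | γ, τ :: L, κ => ∃ x y, x ≠ y ∧ τ = Equiv.swap x y ∧ (γ x = y ∨ γ y = x) ∧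
      RouteList (τ * γ * τ) L κ

/-- `P` is a *route* from `γ` to `κ`: a set of pairwise distinct transpositions that can be
ordered into a sequence whose successive application transforms `γ` into `κ`. -/
def IsRoute {α : Type*} [Fintype α] [DecidableEq α] (γ κ : Equiv.Perm α)
    (P : Finset (Equiv.Perm α)) : Prop :=
  ∃ L : List (Equiv.Perm α), L.Nodup ∧ L.toFinset = P ∧ RouteList γ L κ

/-- `P` is an *antiroute* from `γ` to `κ`: a route from `γ` to the reverse `κ⁻¹` of `κ`. -/
def IsAntiroute {α : Type*} [Fintype α] [DecidableEq α] (γ κ : Equiv.Perm α)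
    (P : Finset (Equiv.Perm α)) : Prop :=
  IsRoute γ κ⁻¹ P


set_option synthInstance.maxHeartbeats 1000000 in
set_option synthInstance.maxSize 100000 in
set_option maxHeartbeats 2000000 in
set_option maxRecDepth 100000 in
theorem core_aux :
    ∀ y : Fin 5, 0 ≠ y → (finRotate 5 0 = y ∨ finRotate 5 y = 0) →
    ∀ z w : Fin 5, z ≠ w →
      (∀ i, Equiv.swap 0 y i = i ∨ Equiv.swap z w i = i) →
      ((Equiv.swap 0 y * finRotate 5 * Equiv.swap 0 y) z = w ∨
        (Equiv.swap 0 y * finRotate 5 * Equiv.swap 0 y) w = z) →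
    ∀ a b : Fin 5, a ≠ b → (finRotate 5 a = b ∨ finRotate 5 b = a) →
    ∀ c d : Fin 5, c ≠ d →
      ((Equiv.swap a b * finRotate 5 * Equiv.swap a b) c = d ∨
        (Equiv.swap a b * finRotate 5 * Equiv.swap a b) d = c) →
      (∀ i, (Equiv.swap z w * (Equiv.swap 0 y * finRotate 5 * Equiv.swap 0 y) * Equiv.swap z w) i
        = (Equiv.swap c d * (Equiv.swap a b * finRotate 5 * Equiv.swap a b) * Equiv.swap c d) i) →
      ((∀ i, Equiv.swap a b i = Equiv.swap 0 y i) ∧ (∀ i, Equiv.swap c d i = Equiv.swap z w i)) ∨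
      ((∀ i, Equiv.swap a b i = Equiv.swap z w i) ∧ (∀ i, Equiv.swap c d i = Equiv.swap 0 y i)) := by
  decide +kernel

theorem core_conj (g : Equiv.Perm (Fin 5)) (x y z w a b c d : Fin 5)
    (γ : Equiv.Perm (Fin 5)) (hg : g * finRotate 5 * g⁻¹ = γ) (hx : g 0 = x)
    (hxy : x ≠ y) (h1 : γ x = y ∨ γ y = x) (hzw : z ≠ w)
    (hd : ∀ i, Equiv.swap x y i = i ∨ Equiv.swap z w i = i)
    (h2 : (Equiv.swap x y * γ * Equiv.swap x y) z = w ∨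
      (Equiv.swap x y * γ * Equiv.swap x y) w = z)
    (hab : a ≠ b) (h3 : γ a = b ∨ γ b = a) (hcd : c ≠ d)
    (h4 : (Equiv.swap a b * γ * Equiv.swap a b) c = d ∨
      (Equiv.swap a b * γ * Equiv.swap a b) d = c)
    (he : Equiv.swap z w * (Equiv.swap x y * γ * Equiv.swap x y) * Equiv.swap z w
        = Equiv.swap c d * (Equiv.swap a b * γ * Equiv.swap a b) * Equiv.swap c d) :
    (Equiv.swap a b = Equiv.swap x y ∧ Equiv.swap c d = Equiv.swap z w) ∨
    (Equiv.swap a b = Equiv.swap z w ∧ Equiv.swap c d = Equiv.swap x y) := by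
  subst hx
  obtain ⟨y, rfl⟩ := g.surjective y
  obtain ⟨z, rfl⟩ := g.surjective z
  obtain ⟨w, rfl⟩ := g.surjective w
  obtain ⟨a, rfl⟩ := g.surjective a
  obtain ⟨b, rfl⟩ := g.surjective b
  obtain ⟨c, rfl⟩ := g.surjective c
  obtain ⟨d, rfl⟩ := g.surjective d
  subst hg
  have key := core_aux y (fun h => hxy (by rw [h])) (by simpa using h1) z w
    (fun h => hzw (by rw [h]))
    (by
      intro i
      simpa [Equiv.swap_apply_apply] using hd (g i))
    (by simpa [Equiv.swap_apply_apply] using h2) a b (fun h => hab (by rw [h]))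
    (by simpa using h3) c d (fun h => hcd (by rw [h]))
    (by simpa [Equiv.swap_apply_apply] using h4)
    (by
      intro i
      have := Equiv.congr_fun he (g i)
      simpa [Equiv.swap_apply_apply] using this)
  simp only [Equiv.swap_apply_apply]
  rcases key with ⟨k1, k2⟩ | ⟨k1, k2⟩
  · left
    rw [Equiv.ext k1, Equiv.ext k2]
    exact ⟨rfl, rfl⟩
  · right
    rw [Equiv.ext k1, Equiv.ext k2]
    exact ⟨rfl, rfl⟩

theorem exists_conj (γ : Equiv.Perm (Fin 5)) (hγ : IsCyclicPerm γ) (x : Fin 5) :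
    ∃ g : Equiv.Perm (Fin 5), g * finRotate 5 * g⁻¹ = γ ∧ g 0 = x := by
  have h : IsConj (finRotate 5) γ := by
    apply Equiv.Perm.IsCycle.isConj isCycle_finRotate hγ.1
    rw [hγ.2, support_finRotate]
  obtain ⟨g, hg⟩ := isConj_iff.1 h
  have rot : ∀ k : Fin 5, (finRotate 5 ^ k.val) 0 = k := by decide +kernel
  refine ⟨g * finRotate 5 ^ (g⁻¹ x).val, ?_, ?_⟩
  · rw [← hg]
    group
  · rw [Equiv.Perm.mul_apply, rot]
    simp

theorem route_two (γ κ : Equiv.Perm (Fin 5)) (P : Finset (Equiv.Perm (Fin 5)))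
    (h : IsRoute γ κ P) (hc : P.card = 2) :
    ∃ x y z w : Fin 5, x ≠ y ∧ (γ x = y ∨ γ y = x) ∧ z ≠ w ∧
      ((Equiv.swap x y * γ * Equiv.swap x y) z = w ∨
        (Equiv.swap x y * γ * Equiv.swap x y) w = z) ∧
      Equiv.swap z w * (Equiv.swap x y * γ * Equiv.swap x y) * Equiv.swap z w = κ ∧
      P = {Equiv.swap x y, Equiv.swap z w} := by
  obtain ⟨L, hn, rfl, hr⟩ := h
  rw [List.toFinset_card_of_nodup hn] at hc
  obtain ⟨u, v, rfl⟩ := List.length_eq_two.1 hc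
  obtain ⟨x, y, hxy, rfl, h1, z, w, hzw, rfl, h2, h3⟩ := hr
  exact ⟨x, y, z, w, hxy, h1, hzw, h2, h3, by simp⟩

/-- If `γ ≠ κ` are cyclic permutations of `{0,1,2,3,4}` and `P = {(x y), (z w)}` is a route of
size 2 from `γ` to `κ` whose two transpositions have disjoint supports (four distinct symbols
in total), then `P` is the only route of size 2 from `γ` to `κ`. -/
theorem route_unique_of_disjoint_supports
    (γ κ : Equiv.Perm (Fin 5)) (hγ : IsCyclicPerm γ) (hκ : IsCyclicPerm κ) (hne : γ ≠ κ)
    (x y z w : Fin 5)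
    (hxy : x ≠ y) (hxz : x ≠ z) (hxw : x ≠ w) (hyz : y ≠ z) (hyw : y ≠ w) (hzw : z ≠ w)
    (P : Finset (Equiv.Perm (Fin 5)))
    (hP : P = {Equiv.swap x y, Equiv.swap z w})
    (hroute : IsRoute γ κ P) (hcard : P.card = 2) :
    ∀ Q : Finset (Equiv.Perm (Fin 5)), IsRoute γ κ Q → Q.card = 2 → Q = P := by
  intro Q hQ hQc
  obtain ⟨x', y', z', w', h1, h2, h3, h4, h5, h6⟩ := route_two γ κ P hroute hcard
  obtain ⟨g, hg, hx⟩ := exists_conj γ hγ x'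
  obtain ⟨a, b, c, d, k1, k2, k3, k4, k5, k6⟩ := route_two γ κ Q hQ hQc
  have hdis : Equiv.Perm.Disjoint (Equiv.swap x y) (Equiv.swap z w) :=
    Equiv.Perm.disjoint_swap_swap (by simp [*])
  have hne2 : Equiv.swap x' y' ≠ Equiv.swap z' w' := by
    intro h
    rw [h6, h] at hcard
    simp at hcard
  have hd : Equiv.Perm.Disjoint (Equiv.swap x' y') (Equiv.swap z' w') := by
    have e := h6.symm.trans hP
    have m1 : Equiv.swap x' y' ∈ ({Equiv.swap x y, Equiv.swap z w} : Finset _) := by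
      rw [← e]; simp
    have m2 : Equiv.swap z' w' ∈ ({Equiv.swap x y, Equiv.swap z w} : Finset _) := by
      rw [← e]; simp
    rw [Finset.mem_insert, Finset.mem_singleton] at m1 m2
    rcases m1 with m1 | m1 <;> rcases m2 with m2 | m2
    · exact absurd (m1.trans m2.symm) hne2
    · rw [m1, m2]; exact hdis
    · rw [m1, m2]; exact hdis.symm
    · exact absurd (m1.trans m2.symm) hne2
  rcases core_conj g x' y' z' w' a b c d γ hg hx h1 h2 h3 hd h4 k1 k2 k3 k4 (h5.trans k5.symm) with
    ⟨e1, e2⟩ | ⟨e1, e2⟩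
  · rw [k6, h6, e1, e2]
  · rw [k6, h6, e1, e2, Finset.pair_comm]
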